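/- Let K be an algebraically closed field of characteristic zero and R = K[x,y,z]. Let φ : ⊕_{j=1}^{n+2} R(-b_j) → R^n (n > 0) be a degree-zero graded homomorphism with b_1 ≤ … ≤ b_{n+2}, each entry φ_{ij} either zero or homogeneous of positive degree, and suppose the ideal of n×n minors of φ has codimension 3, so that M = coker(φ) is Artinian. Set d = Σ_{j=1}^{n+2} b_j and j_0 = ⌊(d−4)/2⌋. Then, as sets, L_M = L_{M,j_0}; that is, a linear form ℓ ∈ R_1 is a Lefschetz element of M if and only if ×ℓ : M_{j_0} → M_{j_0+1} has maximal rank. -/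

import Mathlib

open MvPolynomial

noncomputable section

/-- The height (codimension) of an ideal: the infimum of the heights of the
prime ideals containing it. -/
def idealHeight {R : Type*} [CommRing R] (I : Ideal R) : ℕ∞ :=
  ⨅ (p : PrimeSpectrum R) (_ : I ≤ p.asIdeal), Order.height p

/-- The degree-`z` homogeneous component of `K[x₁, …, x_r]`, for `z : ℤ`
(it is zero in negative degrees). -/
def hcomp (K : Type*) [Field K] (r : ℕ) (z : ℤ) : Submodule K (MvPolynomial (Fin r) K) :=
  if 0 ≤ z then homogeneousSubmodule (Fin r) K z.toNat else ⊥

/-- The degree-`t` graded piece of the cokernel `M` of the graded map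
`φ : ⊕_j R(-b j) → R^n`: the image of the degree-`t` piece `(R^n)_t = ⊕ R_t`. -/
def cokerPiece {K : Type*} [Field K] {n m : ℕ}
    (φ : Matrix (Fin n) (Fin m) (MvPolynomial (Fin 3) K)) (t : ℤ) :
    Submodule K ((Fin n → MvPolynomial (Fin 3) K) ⧸ LinearMap.range φ.mulVecLin) :=
  (Submodule.pi Set.univ fun _ => hcomp K 3 t).map
    ((LinearMap.range φ.mulVecLin).mkQ.restrictScalars K)

end
section GradedPieces

variable {K : Type*} [Field K] {r : ℕ}

theorem mem_hcomp_iff {z : ℤ} {p : MvPolynomial (Fin r) K} :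
    p ∈ hcomp K r z ↔ ∀ m, coeff m p ≠ 0 → (m.degree : ℤ) = z := by
  unfold hcomp
  split_ifs with h
  · rw [mem_homogeneousSubmodule, IsHomogeneous, IsWeightedHomogeneous]
    refine forall_congr' fun m => imp_congr_right fun _ => ?_
    rw [show Finsupp.weight (1 : Fin r → ℕ) m = m.degree from
      (congrArg (fun f => f m) (Finsupp.degree_eq_weight_one (R := ℕ))).symm]
    omega
  · rw [Submodule.mem_bot]
    constructor
    · rintro rfl m hm
      simp at hm
    · intro hp
      ext m
      by_contra hm
      have := hp m hm
      omega

theorem mem_hcomp_of_isHomogeneous {k : ℕ} {p : MvPolynomial (Fin r) K}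
    (hp : p.IsHomogeneous k) : p ∈ hcomp K r k := by
  rw [hcomp, if_pos (Int.natCast_nonneg k), Int.toNat_natCast]
  exact hp

theorem hcomp_of_neg {z : ℤ} (hz : z < 0) : hcomp K r z = ⊥ := by
  rw [hcomp, if_neg (not_le.2 hz)]

theorem mul_mem_hcomp {a b : ℤ} {p q : MvPolynomial (Fin r) K}
    (hp : p ∈ hcomp K r a) (hq : q ∈ hcomp K r b) : p * q ∈ hcomp K r (a + b) := by
  classical
  rw [mem_hcomp_iff] at *
  intro m hm
  rw [coeff_mul] at hm
  obtain ⟨⟨u, v⟩, huv, hne⟩ := Finset.exists_ne_zero_of_sum_ne_zero hm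
  rw [Finset.HasAntidiagonal.mem_antidiagonal] at huv
  rw [← huv, map_add, Nat.cast_add, hp u (left_ne_zero_of_mul hne),
    hq v (right_ne_zero_of_mul hne)]

theorem one_mem_hcomp : (1 : MvPolynomial (Fin r) K) ∈ hcomp K r 0 :=
  mem_hcomp_of_isHomogeneous (k := 0) (isHomogeneous_one _ _)

theorem X_mem_hcomp (i : Fin r) : (X i : MvPolynomial (Fin r) K) ∈ hcomp K r 1 :=
  mem_hcomp_of_isHomogeneous (k := 1) (isHomogeneous_X _ _)

theorem prod_mem_hcomp {ι : Type*} (s : Finset ι) (a : ι → ℤ)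
    (p : ι → MvPolynomial (Fin r) K) (h : ∀ i ∈ s, p i ∈ hcomp K r (a i)) :
    ∏ i ∈ s, p i ∈ hcomp K r (∑ i ∈ s, a i) := by
  classical
  induction s using Finset.induction_on with
  | empty => simpa using one_mem_hcomp
  | insert i s hi ih =>
    rw [Finset.prod_insert hi, Finset.sum_insert hi]
    exact mul_mem_hcomp (h i (Finset.mem_insert_self i s))
      (ih fun j hj => h j (Finset.mem_insert_of_mem hj))

theorem det_mem_hcomp {ι : Type*} [Fintype ι] [DecidableEq ι] (a c : ι → ℤ)
    (A : Matrix ι ι (MvPolynomial (Fin r) K)) (hA : ∀ i j, A i j ∈ hcomp K r (a i + c j)) :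
    A.det ∈ hcomp K r (∑ i, a i + ∑ i, c i) := by
  rw [Matrix.det_apply]
  refine Submodule.sum_mem _ fun τ _ => ?_
  have h := prod_mem_hcomp Finset.univ _ _ fun i _ => hA (τ i) i
  rw [Finset.sum_add_distrib, Equiv.sum_comp τ a] at h
  rcases Int.units_eq_one_or (Equiv.Perm.sign τ) with hs | hs
  · simpa [hs] using h
  · simpa [hs] using h

/-- The projection of a polynomial onto its component of degree `z`. -/
noncomputable def hproj (K : Type*) [Field K] (r : ℕ) (z : ℤ) :
    MvPolynomial (Fin r) K →ₗ[K] MvPolynomial (Fin r) K :=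
  if 0 ≤ z then homogeneousComponent z.toNat else 0

theorem coeff_hproj (z : ℤ) (p : MvPolynomial (Fin r) K) (m : Fin r →₀ ℕ) :
    coeff m (hproj K r z p) = if (m.degree : ℤ) = z then coeff m p else 0 := by
  unfold hproj
  split_ifs with h h' h'
  · rw [coeff_homogeneousComponent, if_pos (by omega)]
  · rw [coeff_homogeneousComponent, if_neg (by omega)]
  · omega
  · simp

theorem hproj_mem (z : ℤ) (p : MvPolynomial (Fin r) K) : hproj K r z p ∈ hcomp K r z := by
  rw [mem_hcomp_iff]
  intro m hm
  rw [coeff_hproj] at hm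
  by_contra h
  exact hm (if_neg h)

theorem hproj_eq_self {z : ℤ} {p : MvPolynomial (Fin r) K} (hp : p ∈ hcomp K r z) :
    hproj K r z p = p := by
  ext m
  rw [coeff_hproj]
  split_ifs with h
  · rfl
  · by_contra hm
    exact h (mem_hcomp_iff.1 hp m (Ne.symm hm))

theorem hproj_mul {a : ℤ} {p : MvPolynomial (Fin r) K} (hp : p ∈ hcomp K r a) (z : ℤ)
    (q : MvPolynomial (Fin r) K) : hproj K r z (p * q) = p * hproj K r (z - a) q := by
  classical
  ext m
  have key : ∀ u ∈ Finset.HasAntidiagonal.antidiagonal m,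
      coeff u.1 p * coeff u.2 (hproj K r (z - a) q) =
        if (m.degree : ℤ) = z then coeff u.1 p * coeff u.2 q else 0 := by
    intro u hu
    rw [coeff_hproj]
    rw [Finset.HasAntidiagonal.mem_antidiagonal] at hu
    by_cases h0 : coeff u.1 p = 0
    · simp [h0]
    · have h1 := mem_hcomp_iff.1 hp _ h0
      have h2 : (m.degree : ℤ) = u.1.degree + u.2.degree := by
        rw [← hu, map_add, Nat.cast_add]
      by_cases h : (m.degree : ℤ) = z
      · rw [if_pos h, if_pos (by omega)]
      · rw [if_neg h, if_neg (by omega), mul_zero]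
  rw [coeff_hproj, coeff_mul, coeff_mul, Finset.sum_congr rfl key]
  split_ifs <;> simp

theorem mem_hcomp_of_mul_mem {a z : ℤ} {p q : MvPolynomial (Fin r) K} (hp : p ∈ hcomp K r a)
    (hp0 : p ≠ 0) (h : p * q ∈ hcomp K r (z + a)) : q ∈ hcomp K r z := by
  have h1 := hproj_eq_self h
  rw [hproj_mul hp, add_sub_cancel_right] at h1
  rw [← mul_left_cancel₀ hp0 h1]
  exact hproj_mem z q

instance (z : ℤ) : FiniteDimensional K (hcomp K r z) := by
  by_cases h : 0 ≤ z
  · rw [hcomp, if_pos h]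
    exact Module.Finite.iff_fg.2 (homogeneousSubmodule_fg _ _ _)
  · rw [hcomp, if_neg h]
    infer_instance

/-- Vectors of polynomials whose `j`-th entry is homogeneous of degree `c j`. -/
noncomputable def hvec (K : Type*) [Field K] (r : ℕ) {ι : Type*} (c : ι → ℤ) :
    Submodule K (ι → MvPolynomial (Fin r) K) :=
  Submodule.pi Set.univ fun j => hcomp K r (c j)

theorem mem_hvec {ι : Type*} {c : ι → ℤ} {v : ι → MvPolynomial (Fin r) K} :
    v ∈ hvec K r c ↔ ∀ j, v j ∈ hcomp K r (c j) := by
  simp [hvec, Submodule.mem_pi]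

/-- A vector with homogeneous entries is a family of homogeneous polynomials. -/
noncomputable def hvecEquiv {ι : Type*} (c : ι → ℤ) :
    hvec K r c ≃ₗ[K] ((j : ι) → hcomp K r (c j)) where
  toFun v j := ⟨v.1 j, mem_hvec.1 v.2 j⟩
  invFun w := ⟨fun j => (w j).1, mem_hvec.2 fun j => (w j).2⟩
  map_add' _ _ := rfl
  map_smul' _ _ := rfl
  left_inv _ := rfl
  right_inv _ := rfl

instance {ι : Type*} [Finite ι] (c : ι → ℤ) : FiniteDimensional K (hvec K r c) :=
  Module.Finite.equiv (hvecEquiv c).symm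

theorem finrank_hvec {ι : Type*} [Fintype ι] (c : ι → ℤ) :
    Module.finrank K (hvec K r c) = ∑ j, Module.finrank K (hcomp K r (c j)) := by
  rw [(hvecEquiv c).finrank_eq, Module.finrank_pi_fintype]

theorem hvec_eq_bot {ι : Type*} {c : ι → ℤ} (hc : ∀ j, c j < 0) : hvec K r c = ⊥ := by
  rw [eq_bot_iff]
  intro v hv
  rw [Submodule.mem_bot]
  ext1 j
  have := mem_hvec.1 hv j
  rwa [hcomp_of_neg (hc j)] at this

theorem mulVec_mem_hvec {ι κ : Type*} [Fintype κ] {a : ι → ℤ} {c : κ → ℤ}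
    {A : Matrix ι κ (MvPolynomial (Fin r) K)} (hA : ∀ i j, A i j ∈ hcomp K r (a i - c j))
    {v : κ → MvPolynomial (Fin r) K} (hv : v ∈ hvec K r c) : A.mulVec v ∈ hvec K r a := by
  rw [mem_hvec] at *
  intro i
  refine Submodule.sum_mem _ fun j _ => ?_
  have h := mul_mem_hcomp (hA i j) (hv j)
  rwa [sub_add_cancel] at h

theorem exists_mem_hvec_mulVec_eq {ι κ : Type*} [Fintype κ] {a : ι → ℤ} {c : κ → ℤ}
    {A : Matrix ι κ (MvPolynomial (Fin r) K)} (hA : ∀ i j, A i j ∈ hcomp K r (a i - c j))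
    {v : κ → MvPolynomial (Fin r) K} (hv : A.mulVec v ∈ hvec K r a) :
    ∃ w ∈ hvec K r c, A.mulVec w = A.mulVec v := by
  refine ⟨fun j => hproj K r (c j) (v j), mem_hvec.2 fun j => hproj_mem _ _, ?_⟩
  ext1 i
  rw [← hproj_eq_self (mem_hvec.1 hv i)]
  simp only [Matrix.mulVec, dotProduct, map_sum]
  refine Finset.sum_congr rfl fun j _ => ?_
  rw [hproj_mul (hA i j), sub_sub_cancel]

theorem exists_sum_X_mul {z : ℤ} (hz : 0 ≤ z) {p : MvPolynomial (Fin r) K}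
    (hp : p ∈ hcomp K r (z + 1)) :
    ∃ q : Fin r → MvPolynomial (Fin r) K, (∀ i, q i ∈ hcomp K r z) ∧ p = ∑ i, X i * q i := by
  have h1 : p ∈ Ideal.span (Set.range (X : Fin r → MvPolynomial (Fin r) K)) := by
    rw [← Set.image_univ, mem_ideal_span_X_image]
    intro m hm
    by_contra! h
    have h0 : m = 0 := by
      ext i
      exact h i (Set.mem_univ i)
    have := mem_hcomp_iff.1 hp m (mem_support_iff.1 hm)
    rw [h0] at this
    simp at this
    omega
  obtain ⟨q, hq⟩ := (Ideal.mem_span_range_iff_exists_fun).1 h1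
  refine ⟨fun i => hproj K r z (q i), fun i => hproj_mem _ _, ?_⟩
  rw [← hproj_eq_self hp, ← hq, map_sum]
  refine Finset.sum_congr rfl fun i _ => ?_
  rw [mul_comm, hproj_mul (X_mem_hcomp i), add_sub_cancel_right]

theorem mem_of_X_pow_mem {J : Ideal (MvPolynomial (Fin r) K)} {N : ℕ}
    (hJ : ∀ i, X i ^ N ∈ J) {z : ℤ} (hz : (r * N : ℕ) < z) {p : MvPolynomial (Fin r) K}
    (hp : p ∈ hcomp K r z) : p ∈ J := by
  rw [← support_sum_monomial_coeff p]
  refine Ideal.sum_mem _ fun m hm => ?_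
  have hd := mem_hcomp_iff.1 hp m (mem_support_iff.1 hm)
  obtain ⟨i, hi⟩ : ∃ i, N ≤ m i := by
    by_contra! h
    have h2 : m.degree ≤ r * N := by
      rw [Finsupp.degree_eq_sum]
      calc ∑ i, m i ≤ ∑ _i : Fin r, N := Finset.sum_le_sum fun i _ => (h i).le
        _ = r * N := by simp
    omega
  have hs : m = (m - Finsupp.single i N) + Finsupp.single i N := by
    rw [tsub_add_cancel_of_le]
    simpa using hi
  rw [hs, ← mul_one (coeff _ p), ← monomial_mul, ← X_pow_eq_monomial]
  exact Ideal.mul_mem_left _ _ (hJ i)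

theorem finrank_hcomp_two (z : ℤ) :
    (Module.finrank K (hcomp K 2 z) : ℤ) = max (z + 1) 0 := by
  rcases lt_or_ge z 0 with h | h
  · rw [hcomp_of_neg h, finrank_bot]
    omega
  · obtain ⟨k, rfl⟩ := Int.eq_ofNat_of_zero_le h
    rw [hcomp, if_pos h, homogeneousSubmodule_eq_finsupp_supported]
    let e : {m : Fin 2 →₀ ℕ | m.degree = k} ≃ Fin (k + 1) :=
      { toFun := fun m => ⟨m.1 0, by
          have h2 : m.1.degree = k := m.2
          rw [Finsupp.degree_eq_sum, Fin.sum_univ_two] at h2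
          omega⟩
        invFun := fun i => ⟨Finsupp.single 0 i.1 + Finsupp.single 1 (k - i.1), by
          have := i.2
          change Finsupp.degree _ = k
          rw [map_add, Finsupp.degree_single, Finsupp.degree_single]
          omega⟩
        left_inv := fun m => by
          have h2 : m.1.degree = k := m.2
          rw [Finsupp.degree_eq_sum, Fin.sum_univ_two] at h2
          ext i
          fin_cases i
          · simp
          · simp
            omega
        right_inv := fun i => by simp }
    have h1 := ((AddMonoidAlgebra.supportedEquivFinsupp (R := K) (S := K)
      {m : Fin 2 →₀ ℕ | m.degree = k}).trans (Finsupp.domLCongr e)).finrank_eq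
    have h2 : Module.finrank K (AddMonoidAlgebra.supported K K {m : Fin 2 →₀ ℕ | m.degree = k}) =
        k + 1 := by
      rw [h1, Module.finrank_finsupp_self, Fintype.card_fin]
    rw [Int.toNat_natCast, h2]
    push_cast
    omega

end GradedPieces
section LinearAlgebra

variable {K V V' : Type*} [Field K] [AddCommGroup V] [Module K V] [AddCommGroup V'] [Module K V']

theorem finrank_map_add_finrank_inf_ker (f : V →ₗ[K] V') (W : Submodule K V)
    [FiniteDimensional K W] :
    Module.finrank K (W.map f) + Module.finrank K (W ⊓ LinearMap.ker f : Submodule K V) =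
      Module.finrank K W := by
  rw [← (f.domRestrict W).finrank_range_add_finrank_ker, LinearMap.range_domRestrict,
    LinearMap.ker_domRestrict, ← Submodule.map_comap_subtype, Submodule.finrank_map_subtype_eq]

theorem finrank_map_of_injective {f : V →ₗ[K] V'} (hf : Function.Injective f)
    (W : Submodule K V) : Module.finrank K (W.map f) = Module.finrank K W :=
  (Submodule.equivMapOfInjective f hf W).finrank_eq.symm

theorem finrank_map_sub_finrank_map (f : V →ₗ[K] V') {A B : Submodule K V}
    [FiniteDimensional K A] (hBA : B ≤ A) (hAB : A ⊓ LinearMap.ker f ≤ B) :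
    (Module.finrank K (A.map f) : ℤ) - Module.finrank K (B.map f) =
      Module.finrank K A - Module.finrank K B := by
  have : FiniteDimensional K B := Submodule.finiteDimensional_of_le hBA
  have h : A ⊓ LinearMap.ker f = B ⊓ LinearMap.ker f :=
    le_antisymm (le_inf hAB inf_le_right) (inf_le_inf_right _ hBA)
  have h1 := finrank_map_add_finrank_inf_ker f A
  have h2 := finrank_map_add_finrank_inf_ker f B
  rw [h] at h1
  omega

end LinearAlgebra

section IntegerSequences

theorem exists_ge_iff_of_monotone {a : ℤ → ℤ} (ha : Monotone a) {c lo hi : ℤ}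
    (hlo : ∀ t ≤ lo, a t < c) (hhi : c ≤ a hi) : ∃ s, ∀ t, c ≤ a t ↔ s ≤ t := by
  obtain ⟨s, hs, hmin⟩ := Int.exists_least_of_bdd (P := fun t => c ≤ a t)
    ⟨lo, fun z hz => by
      by_contra! h
      exact absurd (hlo z h.le) (not_lt.2 hz)⟩ ⟨hi, hhi⟩
  exact ⟨s, fun t => ⟨hmin t, fun h => hs.trans (ha h)⟩⟩

theorem sub_reflect_eq_of_convex {k : ℤ → ℤ} {d T : ℤ}
    (hconv : ∀ t, 2 * k t ≤ k (t + 1) + k (t - 1)) (hlow : ∀ t ≤ -T, k t = 0)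
    (hhigh : ∀ t ≥ T, k t = 2 * (t + 1) - d) (t : ℤ) :
    k t - k (d - 2 - t) = 2 * t + 2 - d := by
  have hmono : Monotone fun t => k t - k (t - 1) := monotone_int_of_le_succ fun t => by
    have := hconv t
    rw [add_sub_cancel_right]
    omega
  have hl : ∀ t ≤ -T, k t - k (t - 1) = 0 := fun t ht => by
    rw [hlow t ht, hlow (t - 1) (by omega), sub_zero]
  have hr : ∀ t ≥ T + 1, k t - k (t - 1) = 2 := fun t ht => by
    rw [hhigh t (by omega), hhigh (t - 1) (by omega)]
    ring
  obtain ⟨c, hc⟩ := exists_ge_iff_of_monotone hmono (c := 1) (lo := -T) (hi := T + 1)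
    (fun t ht => by simp [hl t ht]) (by
      have := hr (T + 1) le_rfl
      omega)
  obtain ⟨e, he⟩ := exists_ge_iff_of_monotone hmono (c := 2) (lo := -T) (hi := T + 1)
    (fun t ht => by simp [hl t ht]) (by
      have := hr (T + 1) le_rfl
      omega)
  have hstep : ∀ t, 0 ≤ k t - k (t - 1) ∧ k t - k (t - 1) ≤ 2 := fun t =>
    ⟨(hl _ (min_le_right t (-T))).symm.le.trans (hmono (min_le_left _ _)),
      (hmono (le_max_left t (T + 1))).trans (hr _ (le_max_right _ _)).le⟩
  have hcT : -T < c := by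
    by_contra! h
    have := (hc (-T)).2 h
    simp only [hl (-T) le_rfl] at this
    omega
  have heT : -T < e := by
    by_contra! h
    have := (he (-T)).2 h
    simp only [hl (-T) le_rfl] at this
    omega
  have hform : ∀ t, k t = max (t - c + 1) 0 + max (t - e + 1) 0 := by
    intro t
    rcases le_total t (-T) with h | h
    · rw [hlow t h]
      omega
    · induction t, h using Int.leInduction with
      | base =>
        rw [hlow _ le_rfl]
        omega
      | succ t ht ih =>
        have h1 := hc (t + 1)
        have h2 := he (t + 1)
        have h3 := hstep (t + 1)
        simp only [add_sub_cancel_right] at h1 h2 h3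
        omega
  have hsum : c + e = d := by
    have h1 := hform (max T (max c e))
    rw [hhigh _ (le_max_left _ _)] at h1
    omega
  rw [hform, hform]
  omega

theorem eq_zero_of_monotone_of_eventually {g : ℤ → ℤ} (hg : Monotone g) {T : ℤ}
    (hlow : ∀ t ≤ -T, g t = 0) (hhigh : ∀ t ≥ T, g t = 0) (t : ℤ) : g t = 0 :=
  le_antisymm ((hg (le_max_left t T)).trans (hhigh _ (le_max_right _ _)).le)
    ((hlow _ (min_le_right t (-T))).symm.le.trans (hg (min_le_left _ _)))

end IntegerSequences

section HyperplaneRestriction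

variable {K : Type*} [Field K]

/-- `π` is the graded quotient map of `K[x, y, z]` by the linear form `ℓ`, its target being
identified with a polynomial ring in two variables. -/
structure IsHyperplaneRestriction (ℓ : MvPolynomial (Fin 3) K)
    (π : MvPolynomial (Fin 3) K →ₐ[K] MvPolynomial (Fin 2) K) : Prop where
  ne_zero : ℓ ≠ 0
  mem_hcomp : ℓ ∈ hcomp K 3 1
  map_mem : ∀ {z p}, p ∈ hcomp K 3 z → π p ∈ hcomp K 2 z
  exists_lift : ∀ {z q}, q ∈ hcomp K 2 z → ∃ p ∈ hcomp K 3 z, π p = q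
  map_eq_zero_iff : ∀ {p}, π p = 0 ↔ ℓ ∣ p

theorem map_mem_hcomp_of_linear {r s : ℕ} (f : MvPolynomial (Fin r) K →ₐ[K] MvPolynomial (Fin s) K)
    (hf : ∀ i, (f (X i)).IsHomogeneous 1) {z : ℤ} {p : MvPolynomial (Fin r) K}
    (hp : p ∈ hcomp K r z) : f p ∈ hcomp K s z := by
  rcases lt_or_ge z 0 with h | h
  · rw [hcomp_of_neg h, Submodule.mem_bot] at hp
    rw [hp, map_zero]
    exact zero_mem _
  · rw [hcomp, if_pos h] at hp ⊢
    have h1 := IsHomogeneous.aeval (R := K) hp (fun i => f (X i)) hf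
    rw [one_mul] at h1
    rwa [show f p = aeval (fun i => f (X i)) p from
      DFunLike.congr_fun (MvPolynomial.aeval_unique f) p]

theorem exists_isHyperplaneRestriction {ℓ : MvPolynomial (Fin 3) K} (hℓ : ℓ.IsHomogeneous 1)
    (h0 : ℓ ≠ 0) : ∃ π, IsHyperplaneRestriction ℓ π := by
  have hspan : ℓ ∈ homogeneousSubmodule (Fin 3) K 1 := hℓ
  rw [homogeneousSubmodule_one_eq_span_X, Submodule.mem_span_range_iff_exists_fun] at hspan
  obtain ⟨a, ha⟩ := hspan
  obtain ⟨k, hk⟩ : ∃ k, a k ≠ 0 := by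
    by_contra! h
    exact h0 (by rw [← ha]; simp [h])
  let s : MvPolynomial (Fin 2) K := -∑ j : Fin 2, ((a k)⁻¹ * a (k.succAbove j)) • X j
  let π : MvPolynomial (Fin 3) K →ₐ[K] MvPolynomial (Fin 2) K :=
    aeval (Fin.insertNth (α := fun _ => MvPolynomial (Fin 2) K) k s X)
  let σ : MvPolynomial (Fin 2) K →ₐ[K] MvPolynomial (Fin 3) K := rename k.succAbove
  have hσX : ∀ j, σ (X j) = X (k.succAbove j) := fun j => rename_X _ _
  have hπk : π (X k) = s := by simp [π]
  have hπj : ∀ j, π (X (k.succAbove j)) = X j := fun j => by simp [π]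
  have hℓk : ℓ = a k • X k + ∑ j : Fin 2, a (k.succAbove j) • X (k.succAbove j) := by
    rw [← ha, Fin.sum_univ_succAbove _ k]
  have hσs : X k - σ s = (a k)⁻¹ • ℓ := by
    rw [hℓk, smul_add, smul_smul, inv_mul_cancel₀ hk, one_smul, Finset.smul_sum]
    simp only [s, map_neg, map_sum, map_smul, hσX, smul_smul, sub_neg_eq_add]
  have hπℓ : π ℓ = 0 := by
    rw [hℓk, map_add, map_smul, hπk, map_sum]
    simp only [map_smul, hπj, s, smul_neg, Finset.smul_sum, smul_smul, mul_inv_cancel_left₀ hk]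
    simp
  have hπσ : ∀ q, π (σ q) = q := fun q => by
    have : π.comp σ = AlgHom.id K _ := by
      ext1 j
      simp [hσX, hπj]
    exact DFunLike.congr_fun this q
  have hσπ : ∀ p, ℓ ∣ p - σ (π p) := fun p => by
    have : (Ideal.Quotient.mkₐ K (Ideal.span {ℓ})).comp (σ.comp π) =
        Ideal.Quotient.mkₐ K (Ideal.span {ℓ}) := by
      ext1 i
      refine ((Ideal.Quotient.eq).2 ?_).symm
      change X i - σ (π (X i)) ∈ _
      rcases Fin.eq_self_or_eq_succAbove k i with rfl | ⟨j, rfl⟩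
      · rw [hπk, hσs]
        exact Submodule.smul_of_tower_mem _ _ (Ideal.mem_span_singleton_self ℓ)
      · rw [hπj, hσX, sub_self]
        exact zero_mem _
    rw [← Ideal.mem_span_singleton]
    exact (Ideal.Quotient.eq).1 (DFunLike.congr_fun this p).symm
  refine ⟨π, h0, mem_hcomp_of_isHomogeneous (k := 1) hℓ, fun {z p} hp =>
    map_mem_hcomp_of_linear π (fun i => ?_) hp, fun {z q} hq =>
    ⟨σ q, map_mem_hcomp_of_linear σ (fun j => ?_) hq, hπσ q⟩, fun {p} => ⟨fun hp => ?_, ?_⟩⟩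
  · rcases Fin.eq_self_or_eq_succAbove k i with rfl | ⟨j, rfl⟩
    · rw [hπk]
      exact (IsHomogeneous.sum _ _ _ fun j _ => by
        rw [smul_eq_C_mul]
        exact isHomogeneous_C_mul_X _ _).neg
    · rw [hπj]
      exact isHomogeneous_X _ _
  · rw [hσX]
    exact isHomogeneous_X _ _
  · have := hσπ p
    rwa [hp, map_zero, sub_zero] at this
  · rintro ⟨g, rfl⟩
    rw [map_mul, hπℓ, zero_mul]

end HyperplaneRestriction
section Syzygies

variable {K : Type*} [Field K] {r : ℕ} {ι κ : Type*} [Fintype κ]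

/-- Multiplication by a matrix of polynomials, as a linear map over the base field. -/
noncomputable abbrev mulVecK (A : Matrix ι κ (MvPolynomial (Fin r) K)) :
    (κ → MvPolynomial (Fin r) K) →ₗ[K] (ι → MvPolynomial (Fin r) K) :=
  A.mulVecLin.restrictScalars K

/-- The degree-`t` syzygies of a matrix whose `j`-th column has degree `b j`. -/
noncomputable def syzPiece (A : Matrix ι κ (MvPolynomial (Fin r) K)) (b : κ → ℤ) (t : ℤ) :
    Submodule K (κ → MvPolynomial (Fin r) K) :=
  hvec K r (fun j => t - b j) ⊓ LinearMap.ker (mulVecK A)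

theorem mem_syzPiece {A : Matrix ι κ (MvPolynomial (Fin r) K)} {b : κ → ℤ} {t : ℤ}
    {v : κ → MvPolynomial (Fin r) K} :
    v ∈ syzPiece A b t ↔ (∀ j, v j ∈ hcomp K r (t - b j)) ∧ A.mulVec v = 0 := by
  simp [syzPiece, mem_hvec]

instance (A : Matrix ι κ (MvPolynomial (Fin r) K)) (b : κ → ℤ) (t : ℤ) :
    FiniteDimensional K (syzPiece A b t) :=
  Submodule.finiteDimensional_inf_left _ _

theorem smul_mem_syzPiece {A : Matrix ι κ (MvPolynomial (Fin r) K)} {b : κ → ℤ} {t : ℤ}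
    {p : MvPolynomial (Fin r) K} (hp : p ∈ hcomp K r 1) {v : κ → MvPolynomial (Fin r) K}
    (hv : v ∈ syzPiece A b t) : p • v ∈ syzPiece A b (t + 1) := by
  rw [mem_syzPiece] at *
  refine ⟨fun j => ?_, by rw [Matrix.mulVec_smul, hv.2, smul_zero]⟩
  have := mul_mem_hcomp hp (hv.1 j)
  rwa [show 1 + (t - b j) = t + 1 - b j by ring] at this

omit [Fintype κ] in
theorem lsmul_injective {p : MvPolynomial (Fin r) K} (hp : p ≠ 0) :
    Function.Injective (Algebra.lsmul K K (κ → MvPolynomial (Fin r) K) p) := by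
  intro v w h
  ext1 j
  exact mul_left_cancel₀ hp (congrFun h j)

theorem two_mul_finrank_syzPiece_le (A : Matrix ι κ (MvPolynomial (Fin 2) K)) (b : κ → ℤ)
    (t : ℤ) : 2 * Module.finrank K (syzPiece A b t) ≤
      Module.finrank K (syzPiece A b (t + 1)) + Module.finrank K (syzPiece A b (t - 1)) := by
  let μ (i : Fin 2) := Algebra.lsmul K K (κ → MvPolynomial (Fin 2) K)
    (X i : MvPolynomial (Fin 2) K)
  have hμ : ∀ i, Function.Injective (μ i) := fun i => lsmul_injective (X_ne_zero i)
  have h1 := Submodule.finrank_sup_add_finrank_inf_eq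
    ((syzPiece A b t).map (μ 0)) ((syzPiece A b t).map (μ 1))
  rw [finrank_map_of_injective (hμ 0), finrank_map_of_injective (hμ 1)] at h1
  have h2 : (syzPiece A b t).map (μ 0) ⊔ (syzPiece A b t).map (μ 1) ≤ syzPiece A b (t + 1) := by
    refine sup_le ?_ ?_
    · rintro _ ⟨v, hv, rfl⟩
      exact smul_mem_syzPiece (X_mem_hcomp 0) hv
    · rintro _ ⟨v, hv, rfl⟩
      exact smul_mem_syzPiece (X_mem_hcomp 1) hv
  have h3 : (syzPiece A b t).map (μ 0) ⊓ (syzPiece A b t).map (μ 1) ≤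
      ((syzPiece A b (t - 1)).map (μ 1)).map (μ 0) := by
    rintro _ ⟨⟨v, hv, rfl⟩, ⟨w, hw, hvw⟩⟩
    have hdvd : ∀ j, ∃ g, v j = X 1 * g := fun j => by
      have h4 : (X 1 : MvPolynomial (Fin 2) K) * w j = X 0 * v j := congrFun hvw j
      refine ((X_prime (i := (1 : Fin 2))).dvd_or_dvd (Dvd.intro _ h4)).resolve_left fun h5 => ?_
      rw [X_dvd_X] at h5
      exact absurd h5 (by decide)
    choose g hg using hdvd
    have hvg : v = μ 1 g := funext hg
    refine ⟨v, ⟨g, ?_, hvg.symm⟩, rfl⟩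
    have hv' := mem_syzPiece.1 hv
    refine mem_syzPiece.2 ⟨fun j => ?_, ?_⟩
    · refine mem_hcomp_of_mul_mem (X_mem_hcomp 1) (X_ne_zero 1) ?_
      rw [← hg, show t - 1 - b j + 1 = t - b j by ring]
      exact hv'.1 j
    · have h6 : X (R := K) (1 : Fin 2) • A.mulVec g = 0 := by
        rw [← Matrix.mulVec_smul]
        exact (congrArg A.mulVec hvg).symm.trans hv'.2
      exact (smul_eq_zero.1 h6).resolve_left (X_ne_zero 1)
  have h4 := Submodule.finrank_mono h2
  have h5 := Submodule.finrank_mono h3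
  rw [finrank_map_of_injective (hμ 0), finrank_map_of_injective (hμ 1)] at h5
  omega

theorem finrank_map_mulVecK_add (A : Matrix ι κ (MvPolynomial (Fin r) K)) (b : κ → ℤ) (t : ℤ) :
    Module.finrank K ((hvec K r fun j => t - b j).map (mulVecK A)) +
      Module.finrank K (syzPiece A b t) = ∑ j, Module.finrank K (hcomp K r (t - b j)) := by
  rw [← finrank_hvec]
  exact finrank_map_add_finrank_inf_ker _ _

theorem map_mulVecK_eq [DecidableEq ι] [Fintype ι] {A : Matrix ι κ (MvPolynomial (Fin r) K)}
    {b : κ → ℤ} (hA : ∀ i j, A i j ∈ hcomp K r (b j)) {N : ℕ}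
    (hN : ∀ (k : Fin r) i, ∃ v, A.mulVec v = Pi.single i (X k ^ N : MvPolynomial (Fin r) K))
    {t : ℤ} (ht : (r * N : ℕ) < t) :
    (hvec K r fun j => t - b j).map (mulVecK A) = hvec K r fun _ => t := by
  have hA' : ∀ i j, A i j ∈ hcomp K r (t - (t - b j)) := fun i j => by
    rw [sub_sub_cancel]
    exact hA i j
  refine le_antisymm ?_ fun u hu => ?_
  · rintro _ ⟨v, hv, rfl⟩
    exact mulVec_mem_hvec hA' hv
  · obtain ⟨v, hv⟩ : u ∈ LinearMap.range A.mulVecLin := by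
      rw [← Finset.univ_sum_single u]
      refine Submodule.sum_mem _ fun i _ => ?_
      exact mem_of_X_pow_mem (J := Submodule.comap
        (LinearMap.single (MvPolynomial (Fin r) K) (fun _ : ι => MvPolynomial (Fin r) K) i)
        (LinearMap.range A.mulVecLin)) (fun k => hN k i) ht (mem_hvec.1 hu i)
    have hv' : A.mulVec v = u := hv
    obtain ⟨w, hw, hwv⟩ := exists_mem_hvec_mulVec_eq hA' (v := v) (hv' ▸ hu)
    exact ⟨w, hw, hwv.trans hv'⟩

theorem exists_forall_abs_le (b : κ → ℤ) : ∃ T : ℤ, ∀ j, |b j| ≤ T :=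
  ⟨∑ j, |b j|, fun j => Finset.single_le_sum (f := fun j => |b j|) (fun _ _ => abs_nonneg _)
    (Finset.mem_univ j)⟩

theorem finrank_syzPiece_sub_reflect {n : ℕ} {b : Fin (n + 2) → ℤ}
    {A : Matrix (Fin n) (Fin (n + 2)) (MvPolynomial (Fin 2) K)}
    (hA : ∀ i j, A i j ∈ hcomp K 2 (b j)) {N : ℕ}
    (hN : ∀ (k : Fin 2) i, ∃ v, A.mulVec v = Pi.single i (X k ^ N : MvPolynomial (Fin 2) K))
    (t : ℤ) :
    (Module.finrank K (syzPiece A b t) : ℤ) -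
      Module.finrank K (syzPiece A b (∑ j, b j - 2 - t)) = 2 * t + 2 - ∑ j, b j := by
  obtain ⟨T, hT⟩ := exists_forall_abs_le b
  have hT0 : 0 ≤ T := (abs_nonneg _).trans (hT 0)
  refine sub_reflect_eq_of_convex (k := fun t => (Module.finrank K (syzPiece A b t) : ℤ))
    (T := T + (2 * N : ℕ) + 1) (fun t => ?_) (fun t ht => ?_) (fun t ht => ?_) t
  · exact_mod_cast two_mul_finrank_syzPiece_le A b t
  · have h1 : hvec K 2 (fun j => t - b j) = ⊥ := hvec_eq_bot fun j => by
      have := neg_le_of_abs_le (hT j)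
      omega
    rw [syzPiece, h1, bot_inf_eq, finrank_bot, Nat.cast_zero]
  · have h1 := finrank_map_mulVecK_add A b t
    rw [map_mulVecK_eq hA hN (by omega), finrank_hvec] at h1
    zify at h1
    simp only [finrank_hcomp_two] at h1
    have h2 : ∀ j, max (t - b j + 1) 0 = t + 1 - b j := fun j => by
      have := le_of_abs_le (hT j)
      omega
    have h3 : max (t + 1) 0 = t + 1 := by omega
    simp only [h2, h3, Finset.sum_sub_distrib, Finset.sum_const, Finset.card_univ,
      Fintype.card_fin, nsmul_eq_mul] at h1
    push_cast at h1
    linear_combination h1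

end Syzygies
section MinorPairing

variable {P : Type*} [CommRing P] {n : ℕ}

/-- The square matrix obtained from an `n × (n + 2)` matrix by appending two rows. -/
def appendRows (A : Matrix (Fin n) (Fin (n + 2)) P) (u v : Fin (n + 2) → P) :
    Matrix (Fin (n + 2)) (Fin (n + 2)) P :=
  Matrix.of (Fin.snoc (α := fun _ => Fin (n + 2) → P)
    (Fin.snoc (α := fun _ => Fin (n + 2) → P) (fun i => A i) u) v)

omit [CommRing P] in
theorem appendRows_castSucc_castSucc (A : Matrix (Fin n) (Fin (n + 2)) P)
    (u v : Fin (n + 2) → P) (i : Fin n) : appendRows A u v i.castSucc.castSucc = A i := by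
  refine (Fin.snoc_castSucc (α := fun _ => Fin (n + 2) → P) _ _ _).trans ?_
  exact Fin.snoc_castSucc (α := fun _ => Fin (n + 2) → P) _ _ _

omit [CommRing P] in
theorem appendRows_castSucc_last (A : Matrix (Fin n) (Fin (n + 2)) P)
    (u v : Fin (n + 2) → P) : appendRows A u v (Fin.last n).castSucc = u := by
  refine (Fin.snoc_castSucc (α := fun _ => Fin (n + 2) → P) _ _ _).trans ?_
  exact Fin.snoc_last (α := fun _ => Fin (n + 2) → P) _ _

omit [CommRing P] in
theorem appendRows_last (A : Matrix (Fin n) (Fin (n + 2)) P)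
    (u v : Fin (n + 2) → P) : appendRows A u v (Fin.last (n + 1)) = v :=
  Fin.snoc_last (α := fun _ => Fin (n + 2) → P) _ _

omit [CommRing P] in
theorem appendRows_updateRow_last (A : Matrix (Fin n) (Fin (n + 2)) P)
    (u v w : Fin (n + 2) → P) :
    (appendRows A u v).updateRow (Fin.last (n + 1)) w = appendRows A u w :=
  Fin.update_snoc_last (α := fun _ => Fin (n + 2) → P) _ _ _

omit [CommRing P] in
theorem appendRows_updateRow_castSucc (A : Matrix (Fin n) (Fin (n + 2)) P)
    (u v w : Fin (n + 2) → P) :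
    (appendRows A u v).updateRow (Fin.last n).castSucc w = appendRows A w v := by
  refine (Fin.snoc_update (α := fun _ => Fin (n + 2) → P) _ _ _ _).symm.trans ?_
  exact congrArg (fun B => Fin.snoc (α := fun _ => Fin (n + 2) → P) B v)
    (Fin.update_snoc_last (α := fun _ => Fin (n + 2) → P) _ _ _)

/-- The alternating pairing `(u, v) ↦ det (A; u; v)` given by the maximal minors of `A`. -/
noncomputable def minorPairing (A : Matrix (Fin n) (Fin (n + 2)) P) :
    (Fin (n + 2) → P) →ₗ[P] (Fin (n + 2) → P) →ₗ[P] P :=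
  LinearMap.mk₂ P (fun u v => (appendRows A u v).det)
    (fun u u' v => by
      rw [← appendRows_updateRow_castSucc A 0 v (u + u'),
        ← appendRows_updateRow_castSucc A 0 v u, ← appendRows_updateRow_castSucc A 0 v u']
      exact Matrix.det_updateRow_add _ _ _ _)
    (fun c u v => by
      rw [← appendRows_updateRow_castSucc A 0 v (c • u), ← appendRows_updateRow_castSucc A 0 v u]
      exact Matrix.det_updateRow_smul _ _ _ _)
    (fun u v v' => by
      rw [← appendRows_updateRow_last A u 0 (v + v'), ← appendRows_updateRow_last A u 0 v,
        ← appendRows_updateRow_last A u 0 v']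
      exact Matrix.det_updateRow_add _ _ _ _)
    (fun c u v => by
      rw [← appendRows_updateRow_last A u 0 (c • v), ← appendRows_updateRow_last A u 0 v]
      exact Matrix.det_updateRow_smul _ _ _ _)

theorem minorPairing_apply (A : Matrix (Fin n) (Fin (n + 2)) P) (u v : Fin (n + 2) → P) :
    minorPairing A u v = (appendRows A u v).det :=
  rfl

theorem minorPairing_row (A : Matrix (Fin n) (Fin (n + 2)) P) (u : Fin (n + 2) → P)
    (i : Fin n) : minorPairing A u (A i) = 0 := by
  refine Matrix.det_zero_of_row_eq (i := i.castSucc.castSucc) (j := Fin.last (n + 1))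
    (Fin.castSucc_lt_last _).ne ?_
  rw [appendRows_castSucc_castSucc, appendRows_last]

/-- The syzygies of `A` formed by its maximal minors. -/
noncomputable def minorSyzygy (A : Matrix (Fin n) (Fin (n + 2)) P) :
    (Fin (n + 2) → P) →ₗ[P] (Fin (n + 2) → P) :=
  LinearMap.pi fun j => (minorPairing A).flip (Pi.single j 1)

theorem minorSyzygy_apply (A : Matrix (Fin n) (Fin (n + 2)) P) (u : Fin (n + 2) → P)
    (j : Fin (n + 2)) : minorSyzygy A u j = (appendRows A u (Pi.single j 1)).det :=
  rfl

theorem dotProduct_minorSyzygy (A : Matrix (Fin n) (Fin (n + 2)) P) (u v : Fin (n + 2) → P) :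
    v ⬝ᵥ minorSyzygy A u = minorPairing A u v := by
  rw [LinearMap.pi_apply_eq_sum_univ (minorPairing A u) v]
  refine Finset.sum_congr rfl fun j _ => ?_
  rw [minorSyzygy_apply, minorPairing_apply, smul_eq_mul]
  congr 3
  ext k
  simp [Pi.single_apply, eq_comm]

theorem mulVec_minorSyzygy (A : Matrix (Fin n) (Fin (n + 2)) P) (u : Fin (n + 2) → P) :
    A.mulVec (minorSyzygy A u) = 0 := by
  ext1 i
  exact (dotProduct_minorSyzygy A u (A i)).trans (minorPairing_row A u i)

theorem map_appendRows {Q : Type*} [CommRing Q] (f : P →+* Q)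
    (A : Matrix (Fin n) (Fin (n + 2)) P) (u v : Fin (n + 2) → P) :
    f.mapMatrix (appendRows A u v) = appendRows (A.map f) (f ∘ u) (f ∘ v) := by
  ext i j
  refine Fin.lastCases ?_ (fun i => Fin.lastCases ?_ (fun i => ?_) i) i
  all_goals simp [appendRows_last, appendRows_castSucc_last, appendRows_castSucc_castSucc]

theorem map_minorSyzygy {Q : Type*} [CommRing Q] (f : P →+* Q)
    (A : Matrix (Fin n) (Fin (n + 2)) P) (u : Fin (n + 2) → P) :
    f ∘ minorSyzygy A u = minorSyzygy (A.map f) (f ∘ u) := by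
  ext1 j
  rw [Function.comp_apply, minorSyzygy_apply, minorSyzygy_apply, RingHom.map_det, map_appendRows]
  congr 2
  ext k
  simp [Pi.single_apply, apply_ite f]

theorem minorSyzygy_mem_hcomp {K : Type*} [Field K] {r : ℕ} {b : Fin (n + 2) → ℤ}
    {A : Matrix (Fin n) (Fin (n + 2)) (MvPolynomial (Fin r) K)}
    (hA : ∀ i j, A i j ∈ hcomp K r (b j)) {s : ℤ} {u : Fin (n + 2) → MvPolynomial (Fin r) K}
    (hu : u ∈ hvec K r fun j => s + b j) (j : Fin (n + 2)) :
    minorSyzygy A u j ∈ hcomp K r (s + ∑ j, b j - b j) := by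
  rw [minorSyzygy_apply]
  have h := det_mem_hcomp (Fin.snoc (α := fun _ => ℤ) (Fin.snoc (α := fun _ => ℤ)
    (fun _ : Fin n => 0) s) (-b j)) b (appendRows A u (Pi.single j 1)) fun i k => ?_
  · rw [Fin.sum_univ_castSucc, Fin.sum_univ_castSucc] at h
    simp only [Fin.snoc_castSucc, Fin.snoc_last, Finset.sum_const_zero, zero_add] at h
    rwa [show s + -b j + ∑ j, b j = s + ∑ j, b j - b j by ring] at h
  · refine Fin.lastCases ?_ (fun i => Fin.lastCases ?_ (fun i => ?_) i) i
    · simp only [appendRows_last, Fin.snoc_last]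
      rcases eq_or_ne k j with rfl | hkj
      · rw [Pi.single_eq_same, neg_add_cancel]
        exact one_mem_hcomp
      · rw [Pi.single_eq_of_ne hkj]
        exact zero_mem _
    · simp only [appendRows_castSucc_last, Fin.snoc_last, Fin.snoc_castSucc]
      exact mem_hvec.1 hu k
    · simp only [appendRows_castSucc_castSucc, Fin.snoc_castSucc, zero_add]
      exact hA i k

theorem mem_span_of_minorSyzygy_eq_zero {L : Type*} [Field L]
    {A : Matrix (Fin n) (Fin (n + 2)) L} (hA : LinearIndependent L A.row)
    {u : Fin (n + 2) → L} (hu : minorSyzygy A u = 0) :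
    u ∈ Submodule.span L (Set.range A.row) := by
  by_contra h
  have h1 : LinearIndependent L (Fin.snoc (α := fun _ => Fin (n + 2) → L) A.row u) :=
    linearIndependent_finSnoc.2 ⟨hA, h⟩
  obtain ⟨v, hv⟩ : ∃ v, v ∉ Submodule.span L
      (Set.range (Fin.snoc (α := fun _ => Fin (n + 2) → L) A.row u)) := by
    by_contra! h2
    have h3 := finrank_range_le_card (R := L)
      (Fin.snoc (α := fun _ => Fin (n + 2) → L) A.row u)
    rw [Set.finrank, Submodule.eq_top_iff'.2 h2, finrank_top, Module.finrank_fin_fun,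
      Fintype.card_fin] at h3
    omega
  have h4 : LinearIndependent L (appendRows A u v).row :=
    linearIndependent_finSnoc.2 ⟨h1, hv⟩
  rw [Matrix.linearIndependent_rows_iff_isUnit, Matrix.isUnit_iff_isUnit_det] at h4
  refine h4.ne_zero ?_
  rw [← minorPairing_apply, ← dotProduct_minorSyzygy, hu, dotProduct_zero]

end MinorPairing

section HyperplaneSyzygies

variable {K : Type*} [Field K] {n : ℕ} {b : Fin (n + 2) → ℤ}

theorem exists_eq_algebraMap_of_mul_X_pow {L : Type*} [Field L]
    [Algebra (MvPolynomial (Fin 2) K) L] [IsFractionRing (MvPolynomial (Fin 2) K) L] {N : ℕ}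
    {c : L} {q : Fin 2 → MvPolynomial (Fin 2) K}
    (hq : ∀ k, algebraMap (MvPolynomial (Fin 2) K) L (q k) =
      c * algebraMap (MvPolynomial (Fin 2) K) L (X k ^ N)) :
    ∃ e, algebraMap (MvPolynomial (Fin 2) K) L e = c := by
  have hinj := IsFractionRing.injective (MvPolynomial (Fin 2) K) L
  have h : q 1 * X 0 ^ N = q 0 * X 1 ^ N := by
    apply hinj
    rw [map_mul, map_mul, hq, hq]
    ring
  have h01 : ¬ (X 0 : MvPolynomial (Fin 2) K) ∣ X 1 ^ N := fun hd => by
    have := (X_prime (R := K) (i := (0 : Fin 2))).dvd_of_dvd_pow hd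
    rw [X_dvd_X] at this
    simp at this
  obtain ⟨e, he⟩ := (X_prime (R := K) (i := (0 : Fin 2))).pow_dvd_of_dvd_mul_right N h01
    (Dvd.intro_left _ h)
  refine ⟨e, mul_right_cancel₀ (b := algebraMap (MvPolynomial (Fin 2) K) L (X 0 ^ N)) ?_ ?_⟩
  · rw [Ne, map_eq_zero_iff _ hinj]
    exact pow_ne_zero _ (X_ne_zero 0)
  · rw [← hq 0, he, map_mul, mul_comm]

theorem exists_mem_hvec_of_minorSyzygy_eq_zero
    {A : Matrix (Fin n) (Fin (n + 2)) (MvPolynomial (Fin 2) K)}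
    (hA : ∀ i j, A i j ∈ hcomp K 2 (b j)) {N : ℕ}
    (hN : ∀ (k : Fin 2) i, ∃ v, A.mulVec v = Pi.single i (X k ^ N : MvPolynomial (Fin 2) K))
    {s : ℤ} {u : Fin (n + 2) → MvPolynomial (Fin 2) K} (hu : u ∈ hvec K 2 fun j => s + b j)
    (h : minorSyzygy A u = 0) : ∃ c ∈ hvec K 2 fun _ => s, A.transpose.mulVec c = u := by
  set f := algebraMap (MvPolynomial (Fin 2) K) (FractionRing (MvPolynomial (Fin 2) K)) with hf
  have hinj : Function.Injective f := IsFractionRing.injective _ _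
  choose v hv using hN
  have key : ∀ (c : Fin n → FractionRing (MvPolynomial (Fin 2) K)) k i,
      Matrix.vecMul c (A.map f) ⬝ᵥ (f ∘ v k i) = c i * f (X k ^ N) := fun c k i => by
    have h2 : (A.map f).mulVec (f ∘ v k i) = Pi.single i (f (X k ^ N)) := by
      ext1 j
      rw [← RingHom.map_mulVec, hv]
      rcases eq_or_ne j i with rfl | hji <;> simp [*]
    rw [← Matrix.dotProduct_mulVec, h2, dotProduct_single]
  have hind : LinearIndependent (FractionRing (MvPolynomial (Fin 2) K)) (A.map f).row := by
    rw [Fintype.linearIndependent_iff]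
    intro c hc i
    have h1 := key c 0 i
    rw [Matrix.vecMul_eq_sum, show ∑ i, c i • (A.map f) i = 0 from hc, zero_dotProduct] at h1
    refine (mul_eq_zero.1 h1.symm).resolve_right ?_
    rw [map_eq_zero_iff _ hinj]
    exact pow_ne_zero _ (X_ne_zero _)
  have hker : minorSyzygy (A.map f) (f ∘ u) = 0 := by
    rw [← map_minorSyzygy, h]
    ext1 j
    exact map_zero f
  obtain ⟨c, hc⟩ := (Submodule.mem_span_range_iff_exists_fun
    (FractionRing (MvPolynomial (Fin 2) K))).1
    (mem_span_of_minorSyzygy_eq_zero hind hker)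
  have hc' : Matrix.vecMul c (A.map f) = f ∘ u := by
    rw [Matrix.vecMul_eq_sum]
    exact hc
  have hex : ∀ i, ∃ e, f e = c i := fun i =>
    exists_eq_algebraMap_of_mul_X_pow (N := N) (q := fun k => u ⬝ᵥ v k i) fun k => by
      rw [← key c k i, hc', ← hf, RingHom.map_dotProduct]
  choose e he using hex
  have hu' : A.transpose.mulVec e = u := by
    ext1 j
    apply hinj
    rw [Matrix.mulVec_transpose, RingHom.map_vecMul, show f ∘ e = c from funext he, hc']
    rfl
  obtain ⟨w, hw, hwe⟩ := exists_mem_hvec_mulVec_eq (a := fun j => s + b j) (c := fun _ => s)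
    (A := A.transpose) (v := e) (fun j i => by simpa using hA i j) (hu' ▸ hu)
  exact ⟨w, hw, hwe.trans hu'⟩

theorem finrank_hvec_le_finrank_map_minorSyzygy_add
    {A : Matrix (Fin n) (Fin (n + 2)) (MvPolynomial (Fin 2) K)}
    (hA : ∀ i j, A i j ∈ hcomp K 2 (b j)) {N : ℕ}
    (hN : ∀ (k : Fin 2) i, ∃ v, A.mulVec v = Pi.single i (X k ^ N : MvPolynomial (Fin 2) K))
    (s : ℤ) :
    ∑ j, Module.finrank K (hcomp K 2 (s + b j)) ≤
      Module.finrank K ((hvec K 2 fun j => s + b j).map ((minorSyzygy A).restrictScalars K)) +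
        n * Module.finrank K (hcomp K 2 s) := by
  rw [← finrank_hvec, ← finrank_map_add_finrank_inf_ker ((minorSyzygy A).restrictScalars K)]
  gcongr
  have h1 : hvec K 2 (fun j => s + b j) ⊓ LinearMap.ker ((minorSyzygy A).restrictScalars K) ≤
      (hvec K 2 fun _ : Fin n => s).map (mulVecK A.transpose) := by
    rintro u ⟨hu, hu0⟩
    obtain ⟨c, hc, rfl⟩ := exists_mem_hvec_of_minorSyzygy_eq_zero hA hN hu hu0
    exact ⟨c, hc, rfl⟩
  refine (Submodule.finrank_mono h1).trans ((Submodule.finrank_map_le _ _).trans_eq ?_)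
  rw [finrank_hvec]
  simp

theorem map_mulVec_comp {P Q ι κ : Type*} [Fintype κ] [CommSemiring P] [CommSemiring Q]
    [Algebra K P] [Algebra K Q] (f : P →ₐ[K] Q) (A : Matrix ι κ P) (w : κ → P) :
    (A.map f).mulVec (f ∘ w) = f ∘ A.mulVec w := by
  ext1 i
  simp [Matrix.mulVec, dotProduct]

variable {ℓ : MvPolynomial (Fin 3) K}
  {π : MvPolynomial (Fin 3) K →ₐ[K] MvPolynomial (Fin 2) K}

theorem IsHyperplaneRestriction.exists_mulVec_eq (hπ : IsHyperplaneRestriction ℓ π)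
    {φ : Matrix (Fin n) (Fin (n + 2)) (MvPolynomial (Fin 3) K)}
    (hφ : ∀ i j, φ i j ∈ hcomp K 3 (b j)) {N : ℕ}
    (hN : ∀ (k : Fin 3) i, ∃ v, φ.mulVec v = Pi.single i (X k ^ N : MvPolynomial (Fin 3) K)) :
    ∀ (k : Fin 2) i, ∃ v, (φ.map π).mulVec v =
      Pi.single i (X k ^ (3 * N + 1) : MvPolynomial (Fin 2) K) := fun k i => by
  obtain ⟨p, hp, hpk⟩ := hπ.exists_lift
    (mem_hcomp_of_isHomogeneous (isHomogeneous_X_pow (R := K) k (3 * N + 1)))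
  have h1 : (Pi.single i p : Fin n → MvPolynomial (Fin 3) K) ∈
      hvec K 3 fun _ => ((3 * N + 1 : ℕ) : ℤ) := mem_hvec.2 fun j => by
    rcases eq_or_ne j i with rfl | hji
    · simpa using hp
    · simp [hji]
  rw [← map_mulVecK_eq hφ hN (by push_cast; omega)] at h1
  obtain ⟨w, -, hw⟩ := h1
  refine ⟨π ∘ w, ?_⟩
  ext1 j
  rw [map_mulVec_comp, Function.comp_apply, show φ.mulVec w = Pi.single i p from hw]
  rcases eq_or_ne j i with rfl | hji
  · simpa using hpk
  · simp [hji]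

theorem IsHyperplaneRestriction.finrank_syzPiece_le (hπ : IsHyperplaneRestriction ℓ π)
    {φ : Matrix (Fin n) (Fin (n + 2)) (MvPolynomial (Fin 3) K)}
    (hφ : ∀ i j, φ i j ∈ hcomp K 3 (b j)) {N : ℕ}
    (hN : ∀ (k : Fin 3) i, ∃ v, φ.mulVec v = Pi.single i (X k ^ N : MvPolynomial (Fin 3) K))
    (t : ℤ) :
    Module.finrank K (syzPiece φ b t) +
        ∑ j, Module.finrank K (hcomp K 2 (t + 1 - ∑ j, b j + b j)) ≤
      Module.finrank K (syzPiece φ b (t + 1)) +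
        n * Module.finrank K (hcomp K 2 (t + 1 - ∑ j, b j)) := by
  have h1 := finrank_hvec_le_finrank_map_minorSyzygy_add (A := φ.map π)
    (fun i j => hπ.map_mem (hφ i j)) (hπ.exists_mulVec_eq hφ hN) (t + 1 - ∑ j, b j)
  have h2 := finrank_map_add_finrank_inf_ker
    (π.toLinearMap.compLeft (Fin (n + 2))) (syzPiece φ b (t + 1))
  have h3 : (syzPiece φ b t).map (Algebra.lsmul K K _ ℓ) ≤
      syzPiece φ b (t + 1) ⊓ LinearMap.ker (π.toLinearMap.compLeft (Fin (n + 2))) := by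
    rintro _ ⟨v, hv, rfl⟩
    refine ⟨smul_mem_syzPiece hπ.mem_hcomp hv, ?_⟩
    ext1 j
    exact hπ.map_eq_zero_iff.2 (dvd_mul_right _ _)
  have h4 : (hvec K 2 fun j => t + 1 - ∑ j, b j + b j).map
      ((minorSyzygy (φ.map π)).restrictScalars K) ≤
      (syzPiece φ b (t + 1)).map (π.toLinearMap.compLeft (Fin (n + 2))) := by
    rintro _ ⟨u, hu, rfl⟩
    choose w hw hwu using fun j => hπ.exists_lift (mem_hvec.1 hu j)
    refine ⟨minorSyzygy φ w, mem_syzPiece.2 ⟨fun j => ?_, mulVec_minorSyzygy φ w⟩, ?_⟩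
    · convert minorSyzygy_mem_hcomp hφ (mem_hvec.2 hw) j using 2
      ring
    · refine (map_minorSyzygy (π : _ →+* MvPolynomial (Fin 2) K) φ w).trans ?_
      rw [show (π : _ →+* MvPolynomial (Fin 2) K) ∘ w = u from funext hwu]
      rfl
  have h5 := Submodule.finrank_mono h3
  rw [finrank_map_of_injective (lsmul_injective hπ.ne_zero)] at h5
  have h6 := Submodule.finrank_mono h4
  omega

end HyperplaneSyzygies

section Duality

variable {K : Type*} [Field K] {n : ℕ} {b : Fin (n + 2) → ℤ}
  {ℓ : MvPolynomial (Fin 3) K} {π : MvPolynomial (Fin 3) K →ₐ[K] MvPolynomial (Fin 2) K}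

theorem IsHyperplaneRestriction.finrank_hcomp_add_one (hπ : IsHyperplaneRestriction ℓ π) (z : ℤ) :
    Module.finrank K (hcomp K 3 (z + 1)) =
      Module.finrank K (hcomp K 3 z) + Module.finrank K (hcomp K 2 (z + 1)) := by
  have h1 : (hcomp K 3 (z + 1)).map π.toLinearMap = hcomp K 2 (z + 1) := by
    refine le_antisymm (Submodule.map_le_iff_le_comap.2 fun p hp => hπ.map_mem hp) fun q hq => ?_
    obtain ⟨p, hp, rfl⟩ := hπ.exists_lift hq
    exact ⟨p, hp, rfl⟩
  have h2 : hcomp K 3 (z + 1) ⊓ LinearMap.ker π.toLinearMap =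
      (hcomp K 3 z).map (LinearMap.mulLeft K ℓ) := by
    ext p
    constructor
    · rintro ⟨hp, hp0⟩
      obtain ⟨q, rfl⟩ := hπ.map_eq_zero_iff.1 hp0
      exact ⟨q, mem_hcomp_of_mul_mem hπ.mem_hcomp hπ.ne_zero hp, rfl⟩
    · rintro ⟨q, hq, rfl⟩
      refine ⟨?_, hπ.map_eq_zero_iff.2 (dvd_mul_right _ _)⟩
      rw [add_comm]
      exact mul_mem_hcomp hπ.mem_hcomp hq
  have h3 : Function.Injective (LinearMap.mulLeft K ℓ) := mul_right_injective₀ hπ.ne_zero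
  rw [← finrank_map_add_finrank_inf_ker π.toLinearMap, h1, h2, finrank_map_of_injective h3,
    add_comm]

section CokerPiece

variable {m : ℕ} (φ : Matrix (Fin n) (Fin m) (MvPolynomial (Fin 3) K))

/-- The quotient map onto the cokernel, as a linear map over the base field. -/
noncomputable abbrev cokerMk : (Fin n → MvPolynomial (Fin 3) K) →ₗ[K]
    (Fin n → MvPolynomial (Fin 3) K) ⧸ LinearMap.range φ.mulVecLin :=
  (LinearMap.range φ.mulVecLin).mkQ.restrictScalars K

theorem cokerPiece_eq_map (t : ℤ) : cokerPiece φ t = (hvec K 3 fun _ => t).map (cokerMk φ) :=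
  rfl

instance (t : ℤ) : FiniteDimensional K (cokerPiece φ t) :=
  inferInstanceAs (FiniteDimensional K ((hvec K 3 fun _ => t).map (cokerMk φ)))

/-- Multiplication by a polynomial on the cokernel, as a linear map over the base field. -/
noncomputable abbrev cokerMul (ℓ : MvPolynomial (Fin 3) K) :
    ((Fin n → MvPolynomial (Fin 3) K) ⧸ LinearMap.range φ.mulVecLin) →ₗ[K]
      (Fin n → MvPolynomial (Fin 3) K) ⧸ LinearMap.range φ.mulVecLin :=
  Algebra.lsmul K K _ ℓ

variable {φ}

theorem cokerMk_eq_zero_iff {v : Fin n → MvPolynomial (Fin 3) K} :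
    cokerMk φ v = 0 ↔ ∃ w, φ.mulVec w = v :=
  Submodule.Quotient.mk_eq_zero _

theorem cokerPiece_of_neg {t : ℤ} (ht : t < 0) : cokerPiece φ t = ⊥ := by
  rw [cokerPiece_eq_map, hvec_eq_bot fun _ => ht, Submodule.map_bot]

theorem map_cokerMul_cokerPiece (t : ℤ) : (cokerPiece φ t).map (cokerMul φ ℓ) =
    ((hvec K 3 fun _ => t).map (Algebra.lsmul K K _ ℓ)).map (cokerMk φ) := by
  rw [cokerPiece_eq_map, ← Submodule.map_comp, ← Submodule.map_comp]
  rfl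

theorem map_cokerMul_cokerPiece_le (hℓ : ℓ ∈ hcomp K 3 1) (t : ℤ) :
    (cokerPiece φ t).map (cokerMul φ ℓ) ≤ cokerPiece φ (t + 1) := by
  rw [map_cokerMul_cokerPiece, cokerPiece_eq_map]
  refine Submodule.map_mono ?_
  rintro _ ⟨v, hv, rfl⟩
  refine mem_hvec.2 fun i => ?_
  rw [add_comm]
  exact mul_mem_hcomp hℓ (mem_hvec.1 hv i)

end CokerPiece

variable {φ : Matrix (Fin n) (Fin (n + 2)) (MvPolynomial (Fin 3) K)}

theorem hvec_inf_ker_cokerMk (hφ : ∀ i j, φ i j ∈ hcomp K 3 (b j)) (t : ℤ) :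
    (hvec K 3 fun _ => t) ⊓ LinearMap.ker (cokerMk φ) =
      (hvec K 3 fun j => t - b j).map (mulVecK φ) := by
  have hφ' : ∀ i j, φ i j ∈ hcomp K 3 (t - (t - b j)) := by simpa using hφ
  ext v
  constructor
  · rintro ⟨hv, hv0⟩
    obtain ⟨w, rfl⟩ := cokerMk_eq_zero_iff.1 hv0
    exact exists_mem_hvec_mulVec_eq hφ' hv
  · rintro ⟨w, hw, rfl⟩
    exact ⟨mulVec_mem_hvec hφ' hw, cokerMk_eq_zero_iff.2 ⟨w, rfl⟩⟩

theorem finrank_cokerPiece_add (hφ : ∀ i j, φ i j ∈ hcomp K 3 (b j)) (t : ℤ) :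
    Module.finrank K (cokerPiece φ t) + ∑ j, Module.finrank K (hcomp K 3 (t - b j)) =
      n * Module.finrank K (hcomp K 3 t) + Module.finrank K (syzPiece φ b t) := by
  have h1 := finrank_map_add_finrank_inf_ker (cokerMk φ) (hvec K 3 fun _ => t)
  rw [hvec_inf_ker_cokerMk hφ, ← cokerPiece_eq_map, finrank_hvec] at h1
  have h2 := finrank_map_mulVecK_add φ b t
  simp only [Finset.sum_const, Finset.card_univ, Fintype.card_fin, smul_eq_mul] at h1
  omega

theorem cokerPiece_of_lt (hφ : ∀ i j, φ i j ∈ hcomp K 3 (b j)) {N : ℕ}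
    (hN : ∀ (k : Fin 3) i, ∃ v, φ.mulVec v = Pi.single i (X k ^ N : MvPolynomial (Fin 3) K))
    {t : ℤ} (ht : (3 * N : ℕ) < t) : cokerPiece φ t = ⊥ := by
  rw [cokerPiece_eq_map, ← map_mulVecK_eq hφ hN ht, ← hvec_inf_ker_cokerMk hφ, eq_bot_iff]
  rintro _ ⟨v, hv, rfl⟩
  exact hv.2

theorem IsHyperplaneRestriction.finrank_cokerPiece_sub (hπ : IsHyperplaneRestriction ℓ π)
    (hφ : ∀ i j, φ i j ∈ hcomp K 3 (b j)) (t : ℤ) :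
    (Module.finrank K (cokerPiece φ (t + 1)) : ℤ) -
        Module.finrank K ((cokerPiece φ t).map (cokerMul φ ℓ)) =
      n * Module.finrank K (hcomp K 2 (t + 1)) -
        ∑ j, (Module.finrank K (hcomp K 2 (t + 1 - b j)) : ℤ) +
          Module.finrank K (syzPiece (φ.map π) b (t + 1)) := by
  set A₀ := hvec K 3 fun _ : Fin n => t + 1
  set M₀ := (hvec K 3 fun j => t + 1 - b j).map (mulVecK φ)
  set B₁ := (hvec K 3 fun _ : Fin n => t).map (Algebra.lsmul K K _ ℓ)
  set ρ := π.toLinearMap.compLeft (Fin n)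
  have hM : A₀ ⊓ LinearMap.ker (cokerMk φ) = M₀ := hvec_inf_ker_cokerMk hφ (t + 1)
  have hB : A₀ ⊓ LinearMap.ker ρ = B₁ := by
    ext v
    constructor
    · rintro ⟨hv, hv0⟩
      choose w hw using fun i => hπ.map_eq_zero_iff.1 (congrFun hv0 i)
      refine ⟨w, mem_hvec.2 fun i => ?_, funext fun i => (hw i).symm⟩
      refine mem_hcomp_of_mul_mem hπ.mem_hcomp hπ.ne_zero ?_
      rw [← hw i]
      exact mem_hvec.1 hv i
    · rintro ⟨w, hw, rfl⟩
      refine ⟨mem_hvec.2 fun i => ?_, funext fun i => hπ.map_eq_zero_iff.2 (dvd_mul_right _ _)⟩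
      rw [add_comm]
      exact mul_mem_hcomp hπ.mem_hcomp (mem_hvec.1 hw i)
  have hle : M₀ ⊔ B₁ ≤ A₀ := sup_le (hM ▸ inf_le_left) (hB ▸ inf_le_left)
  have h1 := finrank_map_sub_finrank_map (cokerMk φ) hle (hM.trans_le le_sup_left)
  have h2 := finrank_map_sub_finrank_map ρ hle (hB.trans_le le_sup_right)
  have e1 : (M₀ ⊔ B₁).map (cokerMk φ) = (cokerPiece φ t).map (cokerMul φ ℓ) := by
    rw [Submodule.map_sup, map_cokerMul_cokerPiece, sup_eq_right]
    refine le_trans ?_ bot_le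
    rw [← hM]
    rintro _ ⟨v, hv, rfl⟩
    exact hv.2
  have e2 : A₀.map ρ = hvec K 2 fun _ => t + 1 := by
    ext v
    constructor
    · rintro ⟨w, hw, rfl⟩
      exact mem_hvec.2 fun i => hπ.map_mem (mem_hvec.1 hw i)
    · intro hv
      choose w hw hwv using fun i => hπ.exists_lift (mem_hvec.1 hv i)
      exact ⟨w, mem_hvec.2 hw, funext hwv⟩
  have e3 : (M₀ ⊔ B₁).map ρ = (hvec K 2 fun j => t + 1 - b j).map (mulVecK (φ.map π)) := by
    have hB0 : B₁.map ρ ≤ ⊥ := by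
      rw [← hB]
      rintro _ ⟨v, hv, rfl⟩
      exact hv.2
    rw [Submodule.map_sup, sup_eq_left.2 (hB0.trans bot_le)]
    ext v
    constructor
    · rintro ⟨_, ⟨w, hw, rfl⟩, rfl⟩
      exact ⟨π ∘ w, mem_hvec.2 fun i => hπ.map_mem (mem_hvec.1 hw i), map_mulVec_comp π φ w⟩
    · rintro ⟨w', hw', rfl⟩
      choose w hw hwv using fun i => hπ.exists_lift (mem_hvec.1 hw' i)
      obtain rfl : π ∘ w = w' := funext hwv
      exact ⟨φ.mulVec w, ⟨w, mem_hvec.2 hw, rfl⟩, (map_mulVec_comp π φ w).symm⟩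
  rw [e1, ← cokerPiece_eq_map] at h1
  rw [e2, e3, finrank_hvec] at h2
  have h3 := finrank_map_mulVecK_add (φ.map π) b (t + 1)
  simp only [Finset.sum_const, Finset.card_univ, Fintype.card_fin, smul_eq_mul] at h2
  push_cast at h2
  zify at h3
  linarith

theorem finrank_hcomp_two_sub (z : ℤ) : (Module.finrank K (hcomp K 2 z) : ℤ) -
    Module.finrank K (hcomp K 2 (-z - 2)) = z + 1 := by
  rw [finrank_hcomp_two, finrank_hcomp_two]
  omega

theorem IsHyperplaneRestriction.finrank_ker_le (hπ : IsHyperplaneRestriction ℓ π)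
    (hφ : ∀ i j, φ i j ∈ hcomp K 3 (b j)) {N : ℕ}
    (hN : ∀ (k : Fin 3) i, ∃ v, φ.mulVec v = Pi.single i (X k ^ N : MvPolynomial (Fin 3) K))
    (t : ℤ) :
    (Module.finrank K (cokerPiece φ t ⊓ LinearMap.ker (cokerMul φ ℓ) : Submodule K _) : ℤ) ≤
      Module.finrank K (cokerPiece φ (∑ j, b j - 4 - t + 1)) -
        Module.finrank K ((cokerPiece φ (∑ j, b j - 4 - t)).map (cokerMul φ ℓ)) := by
  have h1 := finrank_map_add_finrank_inf_ker (cokerMul φ ℓ) (cokerPiece φ t)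
  have h2 := hπ.finrank_cokerPiece_sub hφ t
  have h3 := hπ.finrank_cokerPiece_sub hφ (∑ j, b j - 4 - t)
  have h4 := finrank_cokerPiece_add hφ t
  have h5 := finrank_cokerPiece_add hφ (t + 1)
  have h6 := hπ.finrank_hcomp_add_one t
  have h7 : ∑ j, Module.finrank K (hcomp K 3 (t + 1 - b j)) =
      ∑ j, Module.finrank K (hcomp K 3 (t - b j)) +
        ∑ j, Module.finrank K (hcomp K 2 (t + 1 - b j)) := by
    rw [← Finset.sum_add_distrib]
    refine Finset.sum_congr rfl fun j _ => ?_
    rw [show t + 1 - b j = t - b j + 1 by ring, hπ.finrank_hcomp_add_one]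
  have h8 := finrank_syzPiece_sub_reflect (A := φ.map π) (fun i j => hπ.map_mem (hφ i j))
    (hπ.exists_mulVec_eq hφ hN) (t + 1)
  have h9 := hπ.finrank_syzPiece_le hφ hN t
  have h10 := finrank_hcomp_two_sub (K := K) (t + 1 - ∑ j, b j)
  have h11 : ∑ j, (Module.finrank K (hcomp K 2 (t + 1 - ∑ j, b j + b j)) : ℤ) -
      ∑ j, (Module.finrank K (hcomp K 2 (∑ j, b j - 4 - t + 1 - b j)) : ℤ) =
        (n + 2) * (t + 2 - ∑ j, b j) + ∑ j, b j := by
    rw [← Finset.sum_sub_distrib]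
    have : ∀ j, (Module.finrank K (hcomp K 2 (t + 1 - ∑ j, b j + b j)) : ℤ) -
        Module.finrank K (hcomp K 2 (∑ j, b j - 4 - t + 1 - b j)) =
          (t + 2 - ∑ j, b j) + b j := fun j => by
      rw [show ∑ j, b j - 4 - t + 1 - b j = -(t + 1 - ∑ j, b j + b j) - 2 by ring,
        finrank_hcomp_two_sub]
      ring
    rw [Finset.sum_congr rfl fun j _ => this j, Finset.sum_add_distrib]
    simp only [Finset.sum_const, Finset.card_univ, Fintype.card_fin, nsmul_eq_mul]
    push_cast
    ring
  rw [show -(t + 1 - ∑ j, b j) - 2 = ∑ j, b j - 4 - t + 1 by ring] at h10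
  rw [show ∑ j, b j - 2 - (t + 1) = ∑ j, b j - 4 - t + 1 by ring] at h8
  rw [h6, h7] at h5
  zify at h1 h4 h5 h9
  rw [h3]
  linear_combination (exp := 1) h1 + h2 + h4 - h5 + h8 + h9 + n * h10 - h11

/-- The graded pieces of the cokernel have a symmetric Hilbert function. -/
theorem finrank_cokerPiece_and_finrank_ker (hπ : IsHyperplaneRestriction ℓ π)
    (hφ : ∀ i j, φ i j ∈ hcomp K 3 (b j)) {N : ℕ}
    (hN : ∀ (k : Fin 3) i, ∃ v, φ.mulVec v = Pi.single i (X k ^ N : MvPolynomial (Fin 3) K))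
    (t : ℤ) :
    Module.finrank K (cokerPiece φ t) = Module.finrank K (cokerPiece φ (∑ j, b j - 3 - t)) ∧
    (Module.finrank K (cokerPiece φ t ⊓ LinearMap.ker (cokerMul φ ℓ) : Submodule K _) : ℤ) =
      Module.finrank K (cokerPiece φ (∑ j, b j - 4 - t + 1)) -
        Module.finrank K ((cokerPiece φ (∑ j, b j - 4 - t)).map (cokerMul φ ℓ)) := by
  set d := ∑ j, b j
  have hle : ∀ s : ℤ,
      (Module.finrank K (cokerPiece φ s ⊓ LinearMap.ker (cokerMul φ ℓ) : Submodule K _) : ℤ) ≤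
      Module.finrank K (cokerPiece φ (d - 4 - s + 1)) -
        Module.finrank K ((cokerPiece φ (d - 4 - s)).map (cokerMul φ ℓ)) :=
    fun s => hπ.finrank_ker_le hφ hN s
  have hrk : ∀ s, (Module.finrank K ((cokerPiece φ s).map (cokerMul φ ℓ)) : ℤ) +
      Module.finrank K (cokerPiece φ s ⊓ LinearMap.ker (cokerMul φ ℓ) : Submodule K _) =
      Module.finrank K (cokerPiece φ s) := fun s => by
    exact_mod_cast finrank_map_add_finrank_inf_ker (cokerMul φ ℓ) (cokerPiece φ s)
  set G : ℤ → ℤ := fun s => Module.finrank K (cokerPiece φ s) -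
    Module.finrank K (cokerPiece φ (d - 3 - s)) with hG
  have hstep : ∀ s, G s ≤ G (s + 1) ∧ (G s = G (s + 1) →
      (Module.finrank K (cokerPiece φ s ⊓ LinearMap.ker (cokerMul φ ℓ) : Submodule K _) : ℤ) =
      Module.finrank K (cokerPiece φ (d - 4 - s + 1)) -
        Module.finrank K ((cokerPiece φ (d - 4 - s)).map (cokerMul φ ℓ))) := fun s => by
    have h1 := hle s
    have h2 := hle (d - 4 - s)
    have h3 := hrk s
    have h4 := hrk (d - 4 - s)
    simp only [hG]
    rw [show d - 4 - (d - 4 - s) = s by ring] at h2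
    rw [show d - 3 - (s + 1) = d - 4 - s by ring, show d - 3 - s = d - 4 - s + 1 by ring]
    exact ⟨by linarith, fun h => by linarith⟩
  have hzero : ∀ s, G s = 0 := by
    have hH : ∀ s : ℤ, s < 0 ∨ ((3 * N : ℕ) : ℤ) < s →
        Module.finrank K (cokerPiece φ s) = 0 := by
      rintro s (hs | hs)
      · rw [cokerPiece_of_neg hs, finrank_bot]
      · rw [cokerPiece_of_lt hφ hN hs, finrank_bot]
    refine eq_zero_of_monotone_of_eventually (T := |d| + (3 * N : ℕ) + 4)
      (monotone_int_of_le_succ fun s => (hstep s).1) (fun s hs => ?_) (fun s hs => ?_)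
    all_goals
      have h1 := neg_abs_le d
      have h2 := le_abs_self d
      simp only [hG]
      rw [hH s (by omega), hH (d - 3 - s) (by omega), sub_self]
  refine ⟨?_, (hstep t).2 (by rw [hzero, hzero])⟩
  have := hzero t
  simp only [hG] at this
  omega

end Duality

section FiniteLength

variable {K : Type*} [Field K] {n m : ℕ}

attribute [local instance] MvPolynomial.gradedAlgebra

theorem le_idealOfVars_of_isHomogeneous {r : ℕ} {J : Ideal (MvPolynomial (Fin r) K)}
    (hJ : J.IsHomogeneous (homogeneousSubmodule (Fin r) K)) (hJ' : J ≠ ⊤) :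
    J ≤ idealOfVars (Fin r) K := by
  intro p hp
  rw [← pow_one (idealOfVars (Fin r) K), mem_pow_idealOfVars_iff']
  intro x hx
  obtain rfl : x = 0 := (Finsupp.degree_eq_zero_iff x).1 (Nat.lt_one_iff.1 hx)
  by_contra h0
  have h1 := (mem_iff_homogeneousComponent_mem hJ p).1 hp 0
  rw [homogeneousComponent_zero] at h1
  exact hJ' (J.eq_top_of_isUnit_mem h1 ((isUnit_iff_ne_zero.2 h0).map C))

theorem X_mem_radical_of_isHomogeneous {r : ℕ} {I : Ideal (MvPolynomial (Fin r) K)}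
    (hI : I.IsHomogeneous (homogeneousSubmodule (Fin r) K)) (hht : (r : ℕ∞) ≤ idealHeight I)
    (k : Fin r) : X k ∈ I.radical := by
  rw [Ideal.radical_eq_sInf, Ideal.mem_sInf]
  rintro p ⟨hIp, hp⟩
  set q := (p.homogeneousCore (homogeneousSubmodule (Fin r) K)).toIdeal
  have hqp : q.IsPrime := hp.homogeneousCore
  have hIq : I ≤ q := by
    rw [← hI.toIdeal_homogeneousCore_eq_self]
    exact Ideal.homogeneousCore_mono _ hIp
  have hqm : q ≤ idealOfVars (Fin r) K :=
    le_idealOfVars_of_isHomogeneous (HomogeneousIdeal.isHomogeneous _) hqp.ne_top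
  have hm : idealOfVars (Fin r) K ≠ ⊤ := fun h => by
    have h1 := (C_mem_pow_idealOfVars_iff (σ := Fin r) (R := K) 1 1).1 (by simp [h])
    simp at h1
  obtain ⟨P, hP⟩ := Ideal.nonempty_minimalPrimes hm
  have hPp : P.IsPrime := hP.isPrime
  have hPr : P.height ≤ r := by
    refine (Ideal.height_le_card_of_mem_minimalPrimes_span (Set.finite_range _) hP).trans ?_
    rw [← Nat.card_coe_set_eq]
    exact_mod_cast (Finite.card_range_le _).trans_eq (Nat.card_fin r)
  have hqr : (r : ℕ∞) ≤ q.height := by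
    exact (hht.trans (iInf₂_le (⟨q, hqp⟩ : PrimeSpectrum _) hIq)).trans_eq
      (PrimeSpectrum.height_eq_orderHeight ⟨q, hqp⟩).symm
  have hqP : q = P := eq_of_le_of_not_lt (hqm.trans hP.1.2) fun hlt =>
    (Ideal.height_strict_mono_of_isPrime_of_isPrime hlt).not_ge (hPr.trans hqr)
  have hXq : X k ∈ q := hqP ▸ hP.1.2 (Ideal.subset_span (Set.mem_range_self k))
  exact Ideal.toIdeal_homogeneousCore_le _ p hXq

theorem isHomogeneous_span_minors {r : ℕ} {b : Fin m → ℤ}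
    {φ : Matrix (Fin n) (Fin m) (MvPolynomial (Fin r) K)}
    (hφ : ∀ i j, φ i j ∈ hcomp K r (b j)) :
    (Ideal.span {p | ∃ g : Fin n → Fin m, Function.Injective g ∧
      p = (φ.submatrix id g).det}).IsHomogeneous (homogeneousSubmodule (Fin r) K) := by
  refine Ideal.homogeneous_span _ _ ?_
  rintro _ ⟨g, -, rfl⟩
  have h := det_mem_hcomp 0 (fun i => b (g i)) (φ.submatrix id g) fun i j => by
    simpa using hφ i (g j)
  unfold hcomp at h
  split_ifs at h
  · exact ⟨_, h⟩
  · rw [(Submodule.mem_bot K).1 h]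
    exact ⟨0, zero_mem _⟩

theorem single_det_submatrix_mem_range {P : Type*} [CommRing P]
    (φ : Matrix (Fin n) (Fin m) P) (g : Fin n → Fin m) (i : Fin n) :
    Pi.single i (φ.submatrix id g).det ∈ LinearMap.range φ.mulVecLin := by
  have h : Pi.single i (φ.submatrix id g).det =
      ∑ k, (φ.submatrix id g).adjugate k i • φ.mulVecLin (Pi.single (g k) 1) := by
    ext1 l
    have h1 := congrFun (congrFun (φ.submatrix id g).mul_adjugate l) i
    simp only [Matrix.mul_apply, Matrix.submatrix_apply, id, Matrix.smul_apply, Matrix.one_apply,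
      smul_eq_mul, mul_ite, mul_one, mul_zero] at h1
    simp [Pi.single_apply, ← h1, mul_comm]
  rw [h]
  exact Submodule.sum_mem _ fun k _ => Submodule.smul_mem _ _ (LinearMap.mem_range_self _ _)

theorem exists_forall_mulVec_eq_X_pow {r : ℕ} {b : Fin m → ℤ}
    {φ : Matrix (Fin n) (Fin m) (MvPolynomial (Fin r) K)}
    (hφ : ∀ i j, φ i j ∈ hcomp K r (b j))
    (hht : (r : ℕ∞) ≤ idealHeight (Ideal.span {p | ∃ g : Fin n → Fin m,
      Function.Injective g ∧ p = (φ.submatrix id g).det})) :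
    ∃ N : ℕ, ∀ (k : Fin r) i,
      ∃ v, φ.mulVec v = Pi.single i (X k ^ N : MvPolynomial (Fin r) K) := by
  choose N hN using fun k =>
    X_mem_radical_of_isHomogeneous (isHomogeneous_span_minors hφ) hht k
  refine ⟨∑ k, N k, fun k i => ?_⟩
  have hle : Ideal.span {p | ∃ g : Fin n → Fin m,
      Function.Injective g ∧ p = (φ.submatrix id g).det} ≤
      (LinearMap.range φ.mulVecLin).comap (LinearMap.single _ _ i) := by
    rw [Ideal.span_le]
    rintro _ ⟨g, -, rfl⟩
    exact single_det_submatrix_mem_range φ g i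
  exact hle (Ideal.pow_mem_of_pow_mem _ (hN k)
    (Finset.single_le_sum (fun k _ => Nat.zero_le (N k)) (Finset.mem_univ k)))

end FiniteLength

section Lefschetz

variable {K : Type*} [Field K] {n m : ℕ} {ℓ : MvPolynomial (Fin 3) K}

theorem cokerMul_injOn_iff {φ : Matrix (Fin n) (Fin m) (MvPolynomial (Fin 3) K)} {t : ℤ} :
    (∀ x ∈ cokerPiece φ t, ℓ • x = 0 → x = 0) ↔
      Module.finrank K (cokerPiece φ t ⊓ LinearMap.ker (cokerMul φ ℓ) : Submodule K _) = 0 := by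
  have : FiniteDimensional K (cokerPiece φ t ⊓ LinearMap.ker (cokerMul φ ℓ) : Submodule K _) :=
    Submodule.finiteDimensional_inf_left _ _
  rw [Submodule.finrank_eq_zero, Submodule.eq_bot_iff]
  exact ⟨fun h x hx => h x hx.1 hx.2, fun h x hx hx0 => h x ⟨hx, hx0⟩⟩

theorem cokerMul_surjOn_iff {φ : Matrix (Fin n) (Fin m) (MvPolynomial (Fin 3) K)}
    (hℓ : ℓ ∈ hcomp K 3 1) {t : ℤ} :
    (∀ y ∈ cokerPiece φ (t + 1), ∃ x ∈ cokerPiece φ t, ℓ • x = y) ↔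
      (Module.finrank K (cokerPiece φ (t + 1)) : ℤ) -
        Module.finrank K ((cokerPiece φ t).map (cokerMul φ ℓ)) = 0 := by
  have h : (∀ y ∈ cokerPiece φ (t + 1), ∃ x ∈ cokerPiece φ t, ℓ • x = y) ↔
      cokerPiece φ (t + 1) ≤ (cokerPiece φ t).map (cokerMul φ ℓ) := Iff.rfl
  have hle := map_cokerMul_cokerPiece_le (φ := φ) hℓ t
  rw [h, sub_eq_zero, Nat.cast_inj]
  exact ⟨fun h' => by rw [le_antisymm h' hle],
    fun h' => (Submodule.eq_of_le_of_finrank_eq hle h'.symm).ge⟩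

theorem cokerMul_surjOn_succ {φ : Matrix (Fin n) (Fin m) (MvPolynomial (Fin 3) K)} {t : ℤ}
    (ht : -1 ≤ t) (h : ∀ y ∈ cokerPiece φ (t + 1), ∃ x ∈ cokerPiece φ t, ℓ • x = y) :
    ∀ y ∈ cokerPiece φ (t + 1 + 1), ∃ x ∈ cokerPiece φ (t + 1), ℓ • x = y := by
  rintro _ ⟨v, hv, rfl⟩
  choose q hq hvq using fun i =>
    exists_sum_X_mul (z := t + 1) (by omega) ((mem_hvec (c := fun _ => t + 1 + 1)).1 hv i)
  choose x hx hxq using fun k : Fin 3 => h (cokerMk φ fun i => q i k)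
    ⟨_, mem_hvec.2 fun i => hq i k, rfl⟩
  refine ⟨∑ k, (X k : MvPolynomial (Fin 3) K) • x k, Submodule.sum_mem _ fun k _ =>
    map_cokerMul_cokerPiece_le (X_mem_hcomp k) t ⟨x k, hx k, rfl⟩, ?_⟩
  have hv' : v = ∑ k, (X k : MvPolynomial (Fin 3) K) • fun i => q i k := by
    ext1 i
    simpa using hvq i
  rw [Finset.smul_sum, hv']
  simp only [smul_comm ℓ, hxq]
  exact (map_sum (LinearMap.range φ.mulVecLin).mkQ _ _).symm

theorem cokerMul_surjOn_of_le {φ : Matrix (Fin n) (Fin m) (MvPolynomial (Fin 3) K)} {s t : ℤ}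
    (hs : -1 ≤ s) (h : ∀ y ∈ cokerPiece φ (s + 1), ∃ x ∈ cokerPiece φ s, ℓ • x = y)
    (hst : s ≤ t) : ∀ y ∈ cokerPiece φ (t + 1), ∃ x ∈ cokerPiece φ t, ℓ • x = y := by
  induction t, hst using Int.leInduction with
  | base => exact h
  | succ t hst ih => exact cokerMul_surjOn_succ (hs.trans hst) ih

theorem cokerMul_injOn_iff_surjOn {b : Fin (n + 2) → ℤ}
    {φ : Matrix (Fin n) (Fin (n + 2)) (MvPolynomial (Fin 3) K)}
    (hφ : ∀ i j, φ i j ∈ hcomp K 3 (b j)) {N : ℕ}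
    (hN : ∀ (k : Fin 3) i, ∃ v, φ.mulVec v = Pi.single i (X k ^ N : MvPolynomial (Fin 3) K))
    (hℓ : ℓ.IsHomogeneous 1) (t : ℤ) :
    (∀ x ∈ cokerPiece φ t, ℓ • x = 0 → x = 0) ↔
      ∀ y ∈ cokerPiece φ (∑ j, b j - 4 - t + 1),
        ∃ x ∈ cokerPiece φ (∑ j, b j - 4 - t), ℓ • x = y := by
  rw [cokerMul_injOn_iff, cokerMul_surjOn_iff (mem_hcomp_of_isHomogeneous hℓ)]
  rcases eq_or_ne ℓ 0 with rfl | h0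
  · obtain ⟨π, hπ⟩ := exists_isHyperplaneRestriction (isHomogeneous_X K (0 : Fin 3)) (X_ne_zero 0)
    have h1 := (finrank_cokerPiece_and_finrank_ker hπ hφ hN t).1
    have h2 : cokerMul φ (0 : MvPolynomial (Fin 3) K) = 0 := map_zero _
    rw [h2, LinearMap.ker_zero, inf_top_eq, Submodule.map_zero, finrank_bot, h1,
      show ∑ j, b j - 4 - t + 1 = ∑ j, b j - 3 - t by ring]
    simp
  · obtain ⟨π, hπ⟩ := exists_isHyperplaneRestriction hℓ h0
    rw [← (finrank_cokerPiece_and_finrank_ker hπ hφ hN t).2, Nat.cast_eq_zero]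

theorem cokerPiece_zero_ne_bot (hn : 0 < n)
    {φ : Matrix (Fin n) (Fin m) (MvPolynomial (Fin 3) K)}
    (hφ : ∀ i j, constantCoeff (φ i j) = 0) : cokerPiece φ 0 ≠ ⊥ := by
  intro h
  have h1 : cokerMk φ (fun _ => 1) ∈ cokerPiece φ 0 := ⟨_, mem_hvec.2 fun _ => one_mem_hcomp, rfl⟩
  rw [h, Submodule.mem_bot] at h1
  obtain ⟨w, hw⟩ := cokerMk_eq_zero_iff.1 h1
  have h2 := congrArg constantCoeff (congrFun hw ⟨0, hn⟩)
  simp [Matrix.mulVec, dotProduct, hφ] at h2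

theorem maximal_rank_of_surjOn {b : Fin (n + 2) → ℤ}
    {φ : Matrix (Fin n) (Fin (n + 2)) (MvPolynomial (Fin 3) K)}
    (hφ : ∀ i j, φ i j ∈ hcomp K 3 (b j)) {N : ℕ}
    (hN : ∀ (k : Fin 3) i, ∃ v, φ.mulVec v = Pi.single i (X k ^ N : MvPolynomial (Fin 3) K))
    (hℓ : ℓ.IsHomogeneous 1) {s : ℤ} (hs : -1 ≤ s) (hs' : 2 * s ≤ ∑ j, b j - 3)
    (h : ∀ y ∈ cokerPiece φ (s + 1), ∃ x ∈ cokerPiece φ s, ℓ • x = y) (t : ℤ) :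
    (∀ x ∈ cokerPiece φ t, ℓ • x = 0 → x = 0) ∨
      (∀ y ∈ cokerPiece φ (t + 1), ∃ x ∈ cokerPiece φ t, ℓ • x = y) := by
  rcases le_or_gt s t with hst | hst
  · exact Or.inr (cokerMul_surjOn_of_le hs h hst)
  · refine Or.inl ((cokerMul_injOn_iff_surjOn hφ hN hℓ t).2 ?_)
    exact cokerMul_surjOn_of_le hs h (by omega)

end Lefschetz

/-- Let `K` be algebraically closed of characteristic zero and
`R = K[x,y,z]`.  Let `φ : ⊕_{j=1}^{n+2} R(-b_j) → R^n` (`n > 0`) be a degree-zero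
graded homomorphism with `b₁ ≤ … ≤ b_{n+2}`, each entry zero or homogeneous of
positive degree, whose ideal of `n × n` minors has codimension `3`, and let
`M = coker φ`.  Set `d = ∑ b j` and `j₀ = ⌊(d-4)/2⌋`.  Then, as sets,
`𝔏_M = 𝔏_{M,j₀}`: a linear form `ℓ ∈ R₁` is a Lefschetz element of `M` if and only
if `×ℓ : M_{j₀} → M_{j₀+1}` has maximal rank (is injective or surjective).
(Note that `/` on `ℤ` is floor division by a positive integer.) -/
theorem stmt19 {K : Type*} [Field K] [IsAlgClosed K] [CharZero K]
    (n : ℕ) (hn : 0 < n) (b : Fin (n + 2) → ℤ) (hb : Monotone b)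
    (φ : Matrix (Fin n) (Fin (n + 2)) (MvPolynomial (Fin 3) K))
    -- each entry is zero or homogeneous of positive degree (namely `b j`)
    (hφ : ∀ i j, φ i j = 0 ∨ (0 < b j ∧ (φ i j).IsHomogeneous (b j).toNat))
    (I : Ideal (MvPolynomial (Fin 3) K))
    (hI : I = Ideal.span {m | ∃ g : Fin n → Fin (n + 2),
        Function.Injective g ∧ m = (φ.submatrix id g).det})
    (hht : idealHeight I = 3)
    (d j₀ : ℤ) (hd : d = ∑ j, b j) (hj₀ : j₀ = (d - 4) / 2) :
    ∀ ℓ : MvPolynomial (Fin 3) K, ℓ.IsHomogeneous 1 →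
      ((∀ t : ℤ,
          (∀ x ∈ cokerPiece φ t, ℓ • x = 0 → x = 0) ∨
          (∀ y ∈ cokerPiece φ (t + 1), ∃ x ∈ cokerPiece φ t, ℓ • x = y)) ↔
        ((∀ x ∈ cokerPiece φ j₀, ℓ • x = 0 → x = 0) ∨
          (∀ y ∈ cokerPiece φ (j₀ + 1), ∃ x ∈ cokerPiece φ j₀, ℓ • x = y))) := by
  have hφ' : ∀ i j, φ i j ∈ hcomp K 3 (b j) := fun i j => by
    rcases hφ i j with h | ⟨hb0, h⟩
    · rw [h]
      exact zero_mem _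
    · simpa [Int.toNat_of_nonneg hb0.le] using mem_hcomp_of_isHomogeneous h
  have hφ0 : ∀ i j, constantCoeff (φ i j) = 0 := fun i j => by
    rcases hφ i j with h | ⟨hb0, h⟩
    · rw [h, map_zero]
    · refine h.coeff_eq_zero ?_
      rw [map_zero]
      omega
  obtain ⟨N, hN⟩ := exists_forall_mulVec_eq_X_pow hφ' (hI ▸ hht.ge)
  have hd3 : 3 ≤ d := by
    obtain ⟨π, hπ⟩ := exists_isHyperplaneRestriction (isHomogeneous_X K (0 : Fin 3)) (X_ne_zero 0)
    have h1 := (finrank_cokerPiece_and_finrank_ker hπ hφ' hN 0).1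
    by_contra! hlt
    rw [cokerPiece_of_neg (t := ∑ j, b j - 3 - 0) (by omega), finrank_bot,
      Submodule.finrank_eq_zero] at h1
    exact cokerPiece_zero_ne_bot hn hφ0 h1
  intro ℓ hℓ
  refine ⟨fun h => h j₀, ?_⟩
  rintro (h | h)
  · rw [cokerMul_injOn_iff_surjOn hφ' hN hℓ] at h
    exact maximal_rank_of_surjOn hφ' hN hℓ (by omega) (by omega) h
  · exact maximal_rank_of_surjOn hφ' hN hℓ (by omega) (by omega) h
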